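/- Let f : (0,∞) → ℝ be differentiable and let A be the general spherically symmetric flat SO(3)-connection determined by f, with matrix components A_{μ i}{}^j := Σ_k A_μ{}^k ε_{ki}{}^j. Then on any open ball B ⊆ ℝ³∖{0} the connection is a pure gauge: there exists a differentiable map S : B → SO(3) such that A_{μ i}{}^j(x) = Σ_k ∂_μ (S⁻¹)_i{}^k(x) · S_k{}^j(x) for all x ∈ B. -/

import Mathlib

open Matrix

attribute [local instance] Matrix.normedAddCommGroup Matrix.normedSpace

/-- The totally antisymmetric Levi-Civita symbol on three indices, `eps 0 1 2 = 1`. -/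
noncomputable def eps (i j k : Fin 3) : ℝ :=
  ((j : ℝ) - (i : ℝ)) * ((k : ℝ) - (i : ℝ)) * ((k : ℝ) - (j : ℝ)) / 2

/-- The radius `r = |x|` of a point `x ∈ ℝ³`. -/
noncomputable def rad (x : Fin 3 → ℝ) : ℝ := Real.sqrt (∑ i, x i ^ 2)

/-- The general spherically symmetric flat SO(3)-connection determined by `f`:
`A_μ{}^i = ε_{μij} x_j (cos f - 1)/r² + δ_μ^i sin f / r + x_μ x^i (r f' - sin f)/r³`. -/
noncomputable def Aconn (f : ℝ → ℝ) (x : Fin 3 → ℝ) (μ i : Fin 3) : ℝ :=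
  (∑ j, eps μ i j * x j) * (Real.cos (f (rad x)) - 1) / rad x ^ 2 +
  (if μ = i then (1 : ℝ) else 0) * Real.sin (f (rad x)) / rad x +
  x μ * x i * (rad x * deriv f (rad x) - Real.sin (f (rad x))) / rad x ^ 3

/-- Rodrigues' formula: the rotation about the unit vector `n` by the angle with cosine `c` and
sine `s`. -/
noncomputable def rodrigues (c s : ℝ) (n : Fin 3 → ℝ) : Matrix (Fin 3) (Fin 3) ℝ :=
  fun i j => (if i = j then c else 0) + (1 - c) * (n i * n j) + s * ∑ k, eps k i j * n k

theorem rodrigues_mul_transpose {c s : ℝ} {n : Fin 3 → ℝ} (hcs : s ^ 2 + c ^ 2 = 1)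
    (hn : n 0 ^ 2 + n 1 ^ 2 + n 2 ^ 2 = 1) : rodrigues c s n * (rodrigues c s n)ᵀ = 1 := by
  ext i j
  fin_cases i <;> fin_cases j <;>
    simp [rodrigues, eps, Matrix.mul_apply, Fin.sum_univ_three] <;> grind

theorem det_rodrigues {c s : ℝ} {n : Fin 3 → ℝ} (hcs : s ^ 2 + c ^ 2 = 1)
    (hn : n 0 ^ 2 + n 1 ^ 2 + n 2 ^ 2 = 1) : (rodrigues c s n).det = 1 := by
  simp [rodrigues, eps, Matrix.det_fin_three, Fin.sum_univ_three]
  grind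

theorem rad_sq (x : Fin 3 → ℝ) : rad x ^ 2 = x 0 ^ 2 + x 1 ^ 2 + x 2 ^ 2 := by
  rw [rad, Real.sq_sqrt (by positivity), Fin.sum_univ_three]

theorem rad_pos {x : Fin 3 → ℝ} (hx : x ≠ 0) : 0 < rad x := by
  obtain ⟨i, hi⟩ := Function.ne_iff.mp hx
  refine Real.sqrt_pos.mpr (Finset.sum_pos' (fun _ _ => sq_nonneg _) ⟨i, Finset.mem_univ i, ?_⟩)
  exact sq_pos_of_ne_zero hi

theorem sum_sq_div_rad {x : Fin 3 → ℝ} (hx : x ≠ 0) :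
    (x 0 / rad x) ^ 2 + (x 1 / rad x) ^ 2 + (x 2 / rad x) ^ 2 = 1 := by
  have hr := (rad_pos hx).ne'
  field_simp
  rw [rad_sq]

theorem differentiableAt_rad {x : Fin 3 → ℝ} (hx : x ≠ 0) : DifferentiableAt ℝ rad x := by
  have h : ∑ i, x i ^ 2 ≠ 0 := (Real.sqrt_pos.mp (rad_pos hx)).ne'
  unfold rad
  exact DifferentiableAt.sqrt (by fun_prop) h

theorem fderiv_rad {x : Fin 3 → ℝ} (hx : x ≠ 0) (μ : Fin 3) :
    fderiv ℝ rad x (Pi.single μ 1) = x μ / rad x := by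
  have h : ∑ i, x i ^ 2 ≠ 0 := (Real.sqrt_pos.mp (rad_pos hx)).ne'
  have hd := (HasFDerivAt.fun_sum (u := Finset.univ) fun i _ =>
    (hasFDerivAt_apply (𝕜 := ℝ) i x).pow 2).sqrt h
  rw [show rad = fun y : Fin 3 → ℝ => √(∑ i, y i ^ 2) from rfl, hd.fderiv]
  fin_cases μ <;> simp [Fin.sum_univ_three] <;> field_simp

/-- The gauge transformation `S⁻¹`: the rotation about `x / |x|` by the angle `f |x|`. -/
noncomputable def radialRotation (f : ℝ → ℝ) (x : Fin 3 → ℝ) : Matrix (Fin 3) (Fin 3) ℝ :=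
  rodrigues (Real.cos (f (rad x))) (Real.sin (f (rad x))) (fun i => x i / rad x)

theorem radialRotation_mul_transpose (f : ℝ → ℝ) {x : Fin 3 → ℝ} (hx : x ≠ 0) :
    radialRotation f x * (radialRotation f x)ᵀ = 1 :=
  rodrigues_mul_transpose (Real.sin_sq_add_cos_sq _) (sum_sq_div_rad hx)

theorem hasLineDerivAt_radialRotation {f : ℝ → ℝ} {x : Fin 3 → ℝ} (hx : x ≠ 0)
    (hf : DifferentiableAt ℝ f (rad x)) (μ i k : Fin 3) :
    HasLineDerivAt ℝ (fun y => radialRotation f y i k)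
      ((if i = k then -Real.sin (f (rad x)) * (deriv f (rad x) * (x μ / rad x)) else 0) +
        (Real.sin (f (rad x)) * (deriv f (rad x) * (x μ / rad x)) *
            ((x i / rad x) * (x k / rad x)) +
          (1 - Real.cos (f (rad x))) *
            (((if i = μ then 1 else 0) - (x i / rad x) * (x μ / rad x)) / rad x * (x k / rad x) +
             (x i / rad x) * (((if k = μ then 1 else 0) - (x k / rad x) * (x μ / rad x)) / rad x))) +
        (Real.cos (f (rad x)) * (deriv f (rad x) * (x μ / rad x)) *
            (∑ l, eps l i k * (x l / rad x)) +
          Real.sin (f (rad x)) * ∑ l, eps l i k *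
            (((if l = μ then 1 else 0) - (x l / rad x) * (x μ / rad x)) / rad x)))
      x (Pi.single μ 1) := by
  have hr := (rad_pos hx).ne'
  have hrad : HasDerivAt (fun t : ℝ => rad (x + t • Pi.single μ 1)) (x μ / rad x) 0 := by
    rw [← fderiv_rad hx]
    exact (differentiableAt_rad hx).hasFDerivAt.hasLineDerivAt _
  have hx0 : x + (0 : ℝ) • (Pi.single μ 1 : Fin 3 → ℝ) = x := by simp
  have hfr : HasDerivAt (fun t : ℝ => f (rad (x + t • Pi.single μ 1)))
      (deriv f (rad x) * (x μ / rad x)) 0 :=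
    HasDerivAt.comp (h₂ := f) (0 : ℝ) (by rw [hx0]; exact hf.hasDerivAt) hrad
  have hn : ∀ i : Fin 3, HasDerivAt
      (fun t : ℝ => (x + t • Pi.single μ 1 : Fin 3 → ℝ) i / rad (x + t • Pi.single μ 1))
      (((if i = μ then 1 else 0) - (x i / rad x) * (x μ / rad x)) / rad x) 0 := by
    intro i
    have hi : HasDerivAt (fun t : ℝ => (x + t • Pi.single μ 1 : Fin 3 → ℝ) i)
        (if i = μ then 1 else 0) 0 := by
      simpa [Pi.single_apply] using
        ((hasDerivAt_id (0 : ℝ)).mul_const (if i = μ then (1 : ℝ) else 0)).const_add (x i)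
    refine (hi.fun_div hrad (by rwa [hx0])).congr_deriv ?_
    rw [hx0]
    field_simp
  have hc := hfr.cos
  have hs := hfr.sin
  have h1 : HasDerivAt
      (fun t : ℝ => if i = k then Real.cos (f (rad (x + t • Pi.single μ 1))) else 0)
      (if i = k then -Real.sin (f (rad x)) * (deriv f (rad x) * (x μ / rad x)) else 0) 0 := by
    split_ifs
    · simpa only [hx0] using hc
    · exact hasDerivAt_const _ _
  have h2 := (hc.const_sub 1).fun_mul ((hn i).fun_mul (hn k))
  have h3 := hs.fun_mul (HasDerivAt.fun_sum (u := Finset.univ) fun l _ =>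
    (hn l).const_mul (eps l i k))
  have h := (h1.fun_add h2).fun_add h3
  simp only [hx0, neg_mul, neg_neg] at h
  simp only [neg_mul]
  exact h

theorem differentiableAt_radialRotation_apply {f : ℝ → ℝ} {x : Fin 3 → ℝ} (hx : x ≠ 0)
    (hf : DifferentiableAt ℝ f (rad x)) (i k : Fin 3) :
    DifferentiableAt ℝ (fun y => radialRotation f y i k) x := by
  have hr := (rad_pos hx).ne'
  have hrad := differentiableAt_rad hx
  have hfr : DifferentiableAt ℝ (fun y => f (rad y)) x := hf.comp x hrad
  unfold radialRotation rodrigues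
  split_ifs <;> fun_prop (disch := assumption)

set_option maxHeartbeats 4000000 in
/-- The algebraic core of pure gauge: with `n` a unit vector, `c`, `s` a cosine and a sine, `q` the
inverse radius and `p` the radial derivative of the angle. -/
theorem rodrigues_deriv_mul_transpose {c s p q : ℝ} {n : Fin 3 → ℝ} (hcs : s ^ 2 + c ^ 2 = 1)
    (hn : n 0 ^ 2 + n 1 ^ 2 + n 2 ^ 2 = 1) (μ i j : Fin 3) :
    ∑ k, ((∑ l, eps μ k l * n l) * (c - 1) * q + (if μ = k then 1 else 0) * s * q +
        n μ * n k * (p - s * q)) * eps k i j =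
      ∑ k, ((if i = k then -s * (p * n μ) else 0) +
        (s * (p * n μ) * (n i * n k) +
          (1 - c) * (((if i = μ then 1 else 0) - n i * n μ) * q * n k +
            n i * (((if k = μ then 1 else 0) - n k * n μ) * q))) +
        (c * (p * n μ) * (∑ l, eps l i k * n l) +
          s * ∑ l, eps l i k * (((if l = μ then 1 else 0) - n l * n μ) * q))) *
        rodrigues c s n j k := by
  fin_cases μ <;> fin_cases i <;> fin_cases j <;>
    simp [rodrigues, eps, Fin.sum_univ_three] <;> grind

/-- on any open ball avoiding the origin, the spherically symmetric flat
connection is a pure gauge: `A_{μi}{}^j = ∂_μ(S⁻¹)_i{}^k S_k{}^j` for some differentiable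
map `S` with values in SO(3). -/
theorem stmt9 (f : ℝ → ℝ) (hf : ∀ r > 0, DifferentiableAt ℝ f r)
    (c : Fin 3 → ℝ) (ρ : ℝ) (hB : (0 : Fin 3 → ℝ) ∉ Metric.ball c ρ) :
    ∃ S : (Fin 3 → ℝ) → Matrix (Fin 3) (Fin 3) ℝ,
      (∀ x ∈ Metric.ball c ρ, DifferentiableAt ℝ S x) ∧
      (∀ x ∈ Metric.ball c ρ, (S x)ᵀ * S x = 1 ∧ (S x).det = 1) ∧
      (∀ x ∈ Metric.ball c ρ, ∀ μ i j : Fin 3,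
        ∑ k, Aconn f x μ k * eps k i j =
          ∑ k, fderiv ℝ (fun y => (S y)⁻¹ i k) x (Pi.single μ 1) * S x k j) := by
  have hne : ∀ x ∈ Metric.ball c ρ, x ≠ 0 := fun x hx h => hB (h ▸ hx)
  refine ⟨fun x => (radialRotation f x)ᵀ, fun x hx => ?_, fun x hx => ⟨?_, ?_⟩,
    fun x hx μ i j => ?_⟩
  · exact differentiableAt_pi.mpr fun i => differentiableAt_pi.mpr fun k =>
      differentiableAt_radialRotation_apply (hne x hx) (hf _ (rad_pos (hne x hx))) k i
  · rw [transpose_transpose]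
    exact radialRotation_mul_transpose f (hne x hx)
  · rw [det_transpose]
    exact det_rodrigues (Real.sin_sq_add_cos_sq _) (sum_sq_div_rad (hne x hx))
  · have hx0 := hne x hx
    have hr := (rad_pos hx0).ne'
    have hfx := hf _ (rad_pos hx0)
    have hinv : ∀ k, fderiv ℝ (fun y => ((radialRotation f y)ᵀ)⁻¹ i k) x =
        fderiv ℝ (fun y => radialRotation f y i k) x := by
      refine fun k => Filter.EventuallyEq.fderiv_eq ?_
      filter_upwards [isOpen_ne.mem_nhds hx0] with y hy
      rw [inv_eq_left_inv (radialRotation_mul_transpose f hy)]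
    simp only [hinv]
    simp only [← (differentiableAt_radialRotation_apply hx0 hfx i _).lineDeriv_eq_fderiv,
      (hasLineDerivAt_radialRotation hx0 hfx μ i _).lineDeriv]
    have h := rodrigues_deriv_mul_transpose (n := fun i => x i / rad x)
      (p := deriv f (rad x)) (q := (rad x)⁻¹)
      (Real.sin_sq_add_cos_sq (f (rad x))) (sum_sq_div_rad hx0) μ i j
    simp only [← div_eq_mul_inv] at h
    refine Eq.trans (Finset.sum_congr rfl fun k _ => ?_) h
    congr 1
    simp only [Aconn, Fin.sum_univ_three]
    field_simp
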